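/- Fix β ∈ (−1,1). As Δ = 2−α → 0⁺, the Fisher information of the location parameter converges: I_{μμ}(α) = ∫_ℝ f′(x;α,β)² / f(x;α,β) dx → 1/2, the value of the location information of the N(0,2) distribution. -/

import Mathlib

open MeasureTheory Filter Set Topology Real

/-- Shift parameter ζ = −β·tan(πα/2) in Zolotarev's (M) parameterization. -/
noncomputable def zetaPar (α β : ℝ) : ℝ := -β * Real.tan (Real.pi * α / 2)

/-- Standard stable density in Zolotarev's (M) parameterization, via the inversion formula. -/
noncomputable def stableDensity (α β x : ℝ) : ℝ :=
  (1 / Real.pi) *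
    (∫ t in Set.Ioi (0 : ℝ),
      Complex.exp (-(Complex.I * (t : ℂ) * (x : ℂ))) *
        Complex.exp (-(((t ^ α : ℝ) : ℂ)) *
          (1 + Complex.I * (β : ℂ) * ((Real.tan (Real.pi * α / 2) : ℝ) : ℂ) *
            (((t ^ (1 - α) : ℝ) : ℂ) - 1)))).re

/-- The N(0,2) density f(y;2). -/
noncomputable def normalDensity (y : ℝ) : ℝ :=
  (1 / (2 * Real.sqrt Real.pi)) * Real.exp (-(y ^ 2) / 4)

/-- Partial derivative of the stable density with respect to α. -/
noncomputable def fAlpha (α β x : ℝ) : ℝ := deriv (fun a : ℝ => stableDensity a β x) α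

/-- Partial derivative of the stable density with respect to β. -/
noncomputable def fBeta (α β x : ℝ) : ℝ := deriv (fun b : ℝ => stableDensity α b x) β

/-- Derivative of the stable density in x. -/
noncomputable def fX (α β x : ℝ) : ℝ := deriv (stableDensity α β) x

/-- The scale score numerator f_σ = −f − x·f′. -/
noncomputable def fSig (α β x : ℝ) : ℝ := -stableDensity α β x - x * fX α β x

/-- Functions obtained from nonnegative combinations of characters by pointwise limits. -/
inductive PosChar : (ℝ → ℂ) → Prop
  | base (a b : ℝ) (ha : 0 ≤ a) :
      PosChar (fun t => (a : ℂ) * Complex.exp (Complex.I * (b : ℂ) * (t : ℂ)))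
  | plus (p q : ℝ → ℂ) : PosChar p → PosChar q → PosChar (fun t => p t + q t)
  | lim (u : ℕ → ℝ → ℂ) (q : ℝ → ℂ) : (∀ n, PosChar (u n)) →
      (∀ t, Tendsto (fun n => u n t) atTop (𝓝 (q t))) → PosChar q

namespace PosChar

lemma meas {q : ℝ → ℂ} (h : PosChar q) : Measurable q := by
  induction h with
  | base a b ha => fun_prop
  | plus p q _ _ hp hq => exact hp.add hq
  | lim u q _ hl ih =>
    exact measurable_of_tendsto_metrizable ih (tendsto_pi_nhds.mpr hl)

lemma norm_le {q : ℝ → ℂ} (h : PosChar q) : ∀ t, ‖q t‖ ≤ (q 0).re := by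
  induction h with
  | base a b ha =>
    intro t
    have : Complex.I * (b : ℂ) * (t : ℂ) = ((b * t : ℝ) : ℂ) * Complex.I := by push_cast; ring
    beta_reduce
    rw [this, norm_mul, Complex.norm_exp_ofReal_mul_I]
    simp [abs_of_nonneg ha]
  | plus p q _ _ hp hq =>
    intro t
    have := norm_add_le (p t) (q t)
    have h1 := hp t
    have h2 := hq t
    simp only [Complex.add_re]
    linarith
  | lim u q _ hl ih =>
    intro t
    have h1 := (hl t).norm
    have h2 := (Complex.continuous_re.tendsto _).comp (hl 0)
    exact le_of_tendsto_of_tendsto' h1 h2 (fun n => ih n t)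

lemma congr' {p q : ℝ → ℂ} (h : PosChar p) (e : ∀ t, p t = q t) : PosChar q := by
  have : p = q := funext e
  exact this ▸ h

lemma mul {p q : ℝ → ℂ} (hp : PosChar p) (hq : PosChar q) : PosChar (fun t => p t * q t) := by
  induction hp with
  | base a b ha =>
    induction hq with
    | base a' b' ha' =>
      refine (base (a * a') (b + b') (mul_nonneg ha ha')).congr' fun t => ?_
      have : Complex.I * ((b + b' : ℝ) : ℂ) * (t : ℂ)
        = Complex.I * (b : ℂ) * (t : ℂ) + Complex.I * (b' : ℂ) * (t : ℂ) := by push_cast; ring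
      rw [this, Complex.exp_add]; push_cast; ring
    | plus p q _ _ hp hq => exact (plus _ _ hp hq).congr' fun t => by ring
    | lim u q _ hl ih => exact lim _ _ ih fun t => (hl t).const_mul _
  | plus p q _ _ hp hq => exact (plus _ _ hp hq).congr' fun t => by ring
  | lim u q _ hl ih => exact lim _ _ ih fun t => (hl t).mul_const _

lemma conj {q : ℝ → ℂ} (h : PosChar q) : PosChar (fun t => (starRingEnd ℂ) (q t)) := by
  induction h with
  | base a b ha =>
    refine (base a (-b) ha).congr' fun t => ?_
    simp [← Complex.exp_conj]
  | plus p q _ _ hp hq => exact (plus _ _ hp hq).congr' fun t => by simp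
  | lim u q _ hl ih =>
    exact lim _ _ ih fun t => (Complex.continuous_conj.tendsto _).comp (hl t)

lemma const {a : ℝ} (ha : 0 ≤ a) : PosChar (fun _ => (a : ℂ)) :=
  (base a 0 ha).congr' fun t => by simp

lemma pow {q : ℝ → ℂ} (h : PosChar q) (n : ℕ) : PosChar (fun t => q t ^ n) := by
  induction n with
  | zero => exact (const (zero_le_one)).congr' fun t => by simp
  | succ n ih => exact (ih.mul h).congr' fun t => by rw [pow_succ]

lemma sum {u : ℕ → ℝ → ℂ} (h : ∀ n, PosChar (u n)) (n : ℕ) :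
    PosChar (fun t => ∑ k ∈ Finset.range n, u k t) := by
  induction n with
  | zero => exact (const le_rfl).congr' fun t => by simp
  | succ n ih => exact (plus _ _ ih (h n)).congr' fun t => by rw [Finset.sum_range_succ]

lemma hasSum {u : ℕ → ℝ → ℂ} {q : ℝ → ℂ} (h : ∀ n, PosChar (u n))
    (hs : ∀ t, HasSum (fun n => u n t) (q t)) : PosChar q :=
  lim _ _ (sum h) fun t => (hs t).tendsto_sum_nat

lemma exp {q : ℝ → ℂ} (h : PosChar q) : PosChar (fun t => Complex.exp (q t)) := by
  refine hasSum (u := fun n t => (((n.factorial : ℝ)⁻¹ : ℝ) : ℂ) * q t ^ n)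
    (fun n => (const (by positivity)).mul (h.pow n)) fun t => ?_
  have := NormedSpace.expSeries_div_hasSum_exp (q t)
  rw [← Complex.exp_eq_exp_ℂ] at this
  have e : (fun n : ℕ => (((n.factorial : ℝ)⁻¹ : ℝ) : ℂ) * q t ^ n)
      = fun n : ℕ => q t ^ n / (n.factorial : ℂ) := by
    funext n
    push_cast
    rw [div_eq_inv_mul]
  rw [e]
  exact this

lemma integrable_test {q : ℝ → ℂ} (h : PosChar q) (x : ℝ) {δ : ℝ} (hδ : 0 < δ) :
    Integrable (fun t : ℝ => Complex.exp (-(Complex.I * t * x)) * (q t *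
      (Real.exp (-δ * t ^ 2) : ℝ))) := by
  have := h.meas
  refine ((integrable_exp_neg_mul_sq hδ).const_mul (q 0).re).mono' (by fun_prop) ?_
  refine .of_forall fun t => ?_
  have e : -(Complex.I * (t : ℂ) * x) = ((-(t * x) : ℝ) : ℂ) * Complex.I := by push_cast; ring
  rw [norm_mul, e, Complex.norm_exp_ofReal_mul_I, one_mul, norm_mul, Complex.norm_real,
    Real.norm_eq_abs, abs_of_pos (Real.exp_pos _)]
  exact mul_le_mul_of_nonneg_right (h.norm_le t) (Real.exp_pos _).le

lemma test_base_eq (b x : ℝ) {δ : ℝ} (hδ : 0 < δ) :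
    (∫ t in Ioi (0 : ℝ), Complex.exp (-(Complex.I * t * x)) *
      (Complex.exp (Complex.I * b * t) * (Real.exp (-δ * t ^ 2) : ℝ))).re
      = (π / δ) ^ (1 / 2 : ℝ) * Real.exp (-(b - x) ^ 2 / (4 * δ)) / 2 := by
  set g : ℝ → ℝ := fun t => Real.cos ((b - x) * t) * Real.exp (-δ * t ^ 2) with hg
  have hre : ∀ t : ℝ, (Complex.exp (-(Complex.I * t * x)) *
      (Complex.exp (Complex.I * b * t) * (Real.exp (-δ * t ^ 2) : ℝ))).re = g t := by
    intro t
    rw [← mul_assoc, ← Complex.exp_add]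
    have e : -(Complex.I * (t : ℂ) * x) + Complex.I * b * t
      = (((b - x) * t : ℝ) : ℂ) * Complex.I := by push_cast; ring
    rw [e, Complex.re_mul_ofReal, Complex.exp_ofReal_mul_I_re]
  have hIntg : Integrable (fun t : ℝ => Complex.exp (-(Complex.I * t * x)) *
      (Complex.exp (Complex.I * b * t) * (Real.exp (-δ * t ^ 2) : ℝ))) := by
    have := (base 1 b zero_le_one).integrable_test x hδ
    simpa using this
  have h1 := integral_re (𝕜 := ℂ) hIntg
  have h2 := integral_re (𝕜 := ℂ) (hIntg.integrableOn (s := Ioi (0:ℝ)))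
  simp only [RCLike.re_eq_complex_re, hre] at h1 h2
  rw [← h2]
  have h3 := integral_comp_abs (f := g)
  have h4 : (fun t => g |t|) = g := by
    funext t
    simp only [hg, sq_abs]
    congr 1
    rw [← Real.cos_abs, ← Real.cos_abs ((b - x) * t), abs_mul, abs_mul, abs_abs]
  rw [h4, h1] at h3
  have h5 : (∫ t : ℝ, Complex.exp (-(Complex.I * t * x)) *
      (Complex.exp (Complex.I * b * t) * (Real.exp (-δ * t ^ 2) : ℝ))).re
      = (π / δ) ^ (1 / 2 : ℝ) * Real.exp (-(b - x) ^ 2 / (4 * δ)) := by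
    have := fourierIntegral_gaussian (b := (δ : ℂ)) (by simpa using hδ) ((b - x : ℝ) : ℂ)
    have e : ∀ t : ℝ, Complex.exp (-(Complex.I * t * x)) *
      (Complex.exp (Complex.I * b * t) * (Real.exp (-δ * t ^ 2) : ℝ))
      = Complex.exp (Complex.I * ((b - x : ℝ) : ℂ) * t) * Complex.exp (-δ * t ^ 2) := by
      intro t
      rw [← mul_assoc, ← Complex.exp_add]
      push_cast
      congr 2
      ring
    simp only [e]
    rw [this]
    have e2 : ((π : ℂ) / δ) ^ (1 / 2 : ℂ) * Complex.exp (-((b - x : ℝ) : ℂ) ^ 2 / (4 * δ))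
      = (((π / δ) ^ (1 / 2 : ℝ) * Real.exp (-(b - x) ^ 2 / (4 * δ)) : ℝ) : ℂ) := by
      rw [Complex.ofReal_mul, Complex.ofReal_cpow (by positivity)]
      push_cast
      rfl
    rw [e2, Complex.ofReal_re]
  linarith

lemma test_base (b x : ℝ) {δ : ℝ} (hδ : 0 < δ) :
    0 ≤ (∫ t in Ioi (0 : ℝ), Complex.exp (-(Complex.I * t * x)) *
      (Complex.exp (Complex.I * b * t) * (Real.exp (-δ * t ^ 2) : ℝ))).re := by
  rw [test_base_eq b x hδ]
  positivity

lemma test {q : ℝ → ℂ} (h : PosChar q) (x : ℝ) {δ : ℝ} (hδ : 0 < δ) :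
    0 ≤ (∫ t in Ioi (0 : ℝ), Complex.exp (-(Complex.I * t * x)) *
      (q t * (Real.exp (-δ * t ^ 2) : ℝ))).re := by
  induction h with
  | base a b ha =>
    have e : ∀ t : ℝ, Complex.exp (-(Complex.I * t * x)) *
      ((a : ℂ) * Complex.exp (Complex.I * b * t) * (Real.exp (-δ * t ^ 2) : ℝ))
      = (a : ℂ) * (Complex.exp (-(Complex.I * t * x)) *
      (Complex.exp (Complex.I * b * t) * (Real.exp (-δ * t ^ 2) : ℝ))) := fun t => by ring
    simp only [e]
    rw [integral_const_mul, Complex.re_ofReal_mul]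
    exact mul_nonneg ha (test_base b x hδ)
  | plus p q hp' hq' hp hq =>
    have e : ∀ t : ℝ, Complex.exp (-(Complex.I * t * x)) *
      ((p t + q t) * (Real.exp (-δ * t ^ 2) : ℝ))
      = Complex.exp (-(Complex.I * t * x)) * (p t * (Real.exp (-δ * t ^ 2) : ℝ)) +
      Complex.exp (-(Complex.I * t * x)) * (q t * (Real.exp (-δ * t ^ 2) : ℝ)) := fun t => by ring
    simp only [e]
    rw [integral_add (hp'.integrable_test x hδ).integrableOn
      (hq'.integrable_test x hδ).integrableOn, Complex.add_re]
    exact add_nonneg hp hq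
  | lim u q hu hl ih =>
    obtain ⟨C, hC⟩ : ∃ C, ∀ n, (u n 0).re ≤ C := by
      have h2 : Tendsto (fun n => (u n 0).re) atTop (𝓝 (q 0).re) :=
        (Complex.continuous_re.tendsto _).comp (hl 0)
      obtain ⟨C, hC⟩ := h2.bddAbove_range
      exact ⟨C, fun n => hC ⟨n, rfl⟩⟩
    have key : Tendsto (fun n => ∫ t in Ioi (0 : ℝ), Complex.exp (-(Complex.I * t * x)) *
      (u n t * (Real.exp (-δ * t ^ 2) : ℝ))) atTop (𝓝 (∫ t in Ioi (0 : ℝ),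
        Complex.exp (-(Complex.I * t * x)) * (q t * (Real.exp (-δ * t ^ 2) : ℝ)))) := by
      refine tendsto_integral_of_dominated_convergence
        (fun t => C * Real.exp (-δ * t ^ 2)) ?_ ?_ ?_ ?_
      · intro n
        exact ((hu n).integrable_test x hδ).aestronglyMeasurable.restrict
      · exact ((integrable_exp_neg_mul_sq hδ).const_mul C).integrableOn
      · intro n
        refine .of_forall fun t => ?_
        have e : -(Complex.I * (t : ℂ) * x) = ((-(t * x) : ℝ) : ℂ) * Complex.I := by
          push_cast; ring
        rw [norm_mul, e, Complex.norm_exp_ofReal_mul_I, one_mul, norm_mul, Complex.norm_real,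
          Real.norm_eq_abs, abs_of_pos (Real.exp_pos _)]
        exact mul_le_mul_of_nonneg_right (((hu n).norm_le t).trans (hC n)) (Real.exp_pos _).le
      · exact .of_forall fun t => ((hl t).mul_const _).const_mul _
    exact ge_of_tendsto' ((Complex.continuous_re.tendsto _).comp key) ih

lemma integral_nonneg {q : ℝ → ℂ} (h : PosChar q) (x : ℝ) (hq : IntegrableOn q (Ioi 0)) :
    0 ≤ (∫ t in Ioi (0 : ℝ), Complex.exp (-(Complex.I * t * x)) * q t).re := by
  have key : Tendsto (fun n : ℕ => ∫ t in Ioi (0 : ℝ), Complex.exp (-(Complex.I * t * x)) *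
      (q t * (Real.exp (-(1 / ((n : ℝ) + 1)) * t ^ 2) : ℝ))) atTop (𝓝 (∫ t in Ioi (0 : ℝ),
        Complex.exp (-(Complex.I * t * x)) * q t)) := by
    refine tendsto_integral_of_dominated_convergence (fun t => ‖q t‖) ?_ hq.norm ?_ ?_
    · intro n
      exact (h.integrable_test x (by positivity)).aestronglyMeasurable.restrict
    · intro n
      refine .of_forall fun t => ?_
      have e : -(Complex.I * (t : ℂ) * x) = ((-(t * x) : ℝ) : ℂ) * Complex.I := by
        push_cast; ring
      rw [norm_mul, e, Complex.norm_exp_ofReal_mul_I, one_mul, norm_mul, Complex.norm_real,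
        Real.norm_eq_abs, abs_of_pos (Real.exp_pos _)]
      refine mul_le_of_le_one_right (norm_nonneg _) (Real.exp_le_one_iff.mpr ?_)
      have : 0 ≤ 1 / ((n : ℝ) + 1) * t ^ 2 := by positivity
      linarith
    · refine .of_forall fun t => ?_
      have h0 : Tendsto (fun n : ℕ => Real.exp (-(1 / ((n : ℝ) + 1)) * t ^ 2)) atTop
          (𝓝 (Real.exp (-0 * t ^ 2))) :=
        (Real.continuous_exp.tendsto _).comp
          ((tendsto_one_div_add_atTop_nhds_zero_nat.neg).mul_const _)
      have h1 : Tendsto (fun n : ℕ => ((Real.exp (-(1 / ((n : ℝ) + 1)) * t ^ 2) : ℝ) : ℂ)) atTop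
          (𝓝 ((Real.exp (-0 * t ^ 2) : ℝ) : ℂ)) :=
        (Complex.continuous_ofReal.tendsto _).comp h0
      simpa using (h1.const_mul (q t)).const_mul (Complex.exp (-(Complex.I * t * x)))
  exact ge_of_tendsto' ((Complex.continuous_re.tendsto _).comp key)
    fun n => h.test x (by positivity)

end PosChar

lemma choose_sign {α : ℝ} (h1 : 1 < α) (h2 : α < 2) (n : ℕ) :
    0 ≤ (-1 : ℝ) ^ (n + 2) * Ring.choose α (n + 2) := by
  have hs : ∀ n : ℕ, (descPochhammer ℤ (n + 1)).smeval α
      = (descPochhammer ℤ n).smeval α * (α - n) := by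
    intro n
    simp [descPochhammer_succ_right, Polynomial.smeval_mul, Polynomial.smeval_natCast]
  have h : 0 ≤ (-1 : ℝ) ^ (n + 2) * (descPochhammer ℤ (n + 2)).smeval α := by
    induction n with
    | zero =>
      have := hs 0
      have h' := hs 1
      norm_num at this h'
      norm_num
      rw [h']
      nlinarith
    | succ n ih =>
      rw [show n + 1 + 2 = (n + 2) + 1 from rfl, hs, pow_succ]
      have : (-1 : ℝ) ^ (n + 2) * -1 * ((descPochhammer ℤ (n + 2)).smeval α * (α - ↑(n + 2)))
        = ((-1 : ℝ) ^ (n + 2) * (descPochhammer ℤ (n + 2)).smeval α) * ((n : ℝ) + 2 - α) := by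
        push_cast; ring
      rw [this]
      refine mul_nonneg ih ?_
      have : (0 : ℝ) ≤ n := n.cast_nonneg
      linarith
  rw [Ring.descPochhammer_eq_factorial_smul_choose, nsmul_eq_mul] at h
  have h' : 0 ≤ ((n + 2).factorial : ℝ) * ((-1 : ℝ) ^ (n + 2) * Ring.choose α (n + 2)) := by
    linarith
  exact nonneg_of_mul_nonneg_right h' (by positivity)

/-- Coefficients of `(1 - z) ^ α + α z`. -/
noncomputable def binCoef (α : ℝ) (n : ℕ) : ℝ :=
  (-1 : ℝ) ^ n * Ring.choose α n + (if n = 1 then α else 0)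

lemma binCoef_nonneg {α : ℝ} (h1 : 1 < α) (h2 : α < 2) (n : ℕ) : 0 ≤ binCoef α n := by
  match n with
  | 0 => simp [binCoef]
  | 1 => simp [binCoef]
  | n + 2 => simpa [binCoef] using choose_sign h1 h2 n

lemma binCoef_hasSum (α : ℝ) {z : ℂ} (hz : ‖z‖ < 1) :
    HasSum (fun n => (binCoef α n : ℂ) * z ^ n) ((1 - z) ^ (α : ℂ) + α * z) := by
  have h := (Complex.one_add_cpow_hasFPowerSeriesOnBall_zero (a := (α : ℂ))).hasSum
    (y := -z) (by rw [← ENNReal.ofReal_one, Metric.eball_ofReal]; simpa using hz)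
  have h2 := hasSum_ite_eq (1 : ℕ) ((α : ℂ) * z)
  have h3 := h.add h2
  have e1 : (fun n => (binCoef α n : ℂ) * z ^ n) =
      fun b => ((binomialSeries ℂ (α : ℂ) b) fun _ => -z) + if b = 1 then (α : ℂ) * z else 0 := by
    funext n
    simp only [binCoef, binomialSeries_apply, List.ofFn_const, List.prod_replicate, smul_eq_mul,
      ← Complex.ofReal_choose]
    rw [neg_pow z]
    by_cases hn : n = 1
    · subst hn; simp
    · simp [hn]; ring
  have e2 : (1 - z) ^ (α : ℂ) + α * z = (1 + (0 + -z)) ^ (α : ℂ) + α * z := by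
    rw [zero_add, ← sub_eq_add_neg]
  rw [e1, e2]
  exact h3

lemma real_mul_cpow' {a : ℝ} (ha : 0 < a) (z : ℂ) {w : ℝ} (hw : w ≠ 0) :
    ((a : ℂ) * z) ^ (w : ℂ) = ((a ^ w : ℝ) : ℂ) * z ^ (w : ℂ) := by
  have hw' : (w : ℂ) ≠ 0 := by exact_mod_cast hw
  have ha' : (a : ℂ) ≠ 0 := by exact_mod_cast ha.ne'
  by_cases hz : z = 0
  · simp [hz, hw']
  rw [Complex.ofReal_cpow ha.le, Complex.cpow_def_of_ne_zero (mul_ne_zero ha' hz),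
    Complex.cpow_def_of_ne_zero ha', Complex.cpow_def_of_ne_zero hz, ← Complex.exp_add,
    Complex.log_ofReal_mul ha hz, Complex.ofReal_log ha.le]
  congr 1
  ring

lemma PosChar.approx {α : ℝ} (h1 : 1 < α) (h2 : α < 2) {c s r : ℝ} (hc : 0 ≤ c)
    (hr0 : 0 ≤ r) (hr1 : r < 1) :
    PosChar (fun t => Complex.exp ((c : ℂ) * ((1 - r * Complex.exp (Complex.I * s * t)) ^ (α : ℂ)
      + α * (r * Complex.exp (Complex.I * s * t)) - α * (1 + Complex.I * s * t)))) := by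
  have hb := PosChar.base r s hr0
  have hq : PosChar (fun t => (1 - r * Complex.exp (Complex.I * s * t)) ^ (α : ℂ)
      + α * (r * Complex.exp (Complex.I * s * t))) := by
    refine PosChar.hasSum (fun n => (PosChar.const (binCoef_nonneg h1 h2 n)).mul (hb.pow n))
      fun t => ?_
    refine binCoef_hasSum α ?_
    have : Complex.I * (s : ℂ) * (t : ℂ) = ((s * t : ℝ) : ℂ) * Complex.I := by push_cast; ring
    rw [this, norm_mul, Complex.norm_exp_ofReal_mul_I]
    simpa [abs_of_nonneg hr0] using hr1
  have he := (((PosChar.const hc).mul hq).exp).mul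
    (PosChar.base (Real.exp (-(c * α))) (-(c * α * s)) (Real.exp_pos _).le)
  refine he.congr' fun t => ?_
  push_cast
  rw [← Complex.exp_add, ← Complex.exp_add]
  congr 1
  ring

/-- Spectrally one-sided stable exponent. -/
lemma PosChar.stable {α : ℝ} (h1 : 1 < α) (h2 : α < 2) {c : ℝ} (hc : 0 ≤ c) :
    PosChar (fun t => Complex.exp ((c : ℂ) * (-(Complex.I * t)) ^ (α : ℂ))) := by
  set ε : ℕ → ℝ := fun n => 1 / ((n : ℝ) + 1) with hε
  have hpos : ∀ n, 0 < ε n := fun n => by simp only [hε]; positivity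
  have hle : ∀ n, ε n ≤ 1 := fun n => by
    simp only [hε]
    rw [div_le_one (by positivity)]
    have : (0 : ℝ) ≤ n := n.cast_nonneg
    linarith
  have hlim : Tendsto ε atTop (𝓝 0) := tendsto_one_div_add_atTop_nhds_zero_nat
  refine PosChar.lim _ _ (fun n => PosChar.approx h1 h2 (c := c * (ε n)⁻¹ ^ α) (s := ε n)
    (r := 1 - ε n ^ 2) (mul_nonneg hc (by have := hpos n; positivity)) ?_ ?_) fun t => ?_
  · nlinarith [hle n, hpos n]
  · have := hpos n
    have : 0 < ε n ^ 2 := by positivity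
    linarith
  refine (Complex.continuous_exp.tendsto _).comp ?_
  -- the quadratic remainder
  have hder : Tendsto (fun n => (Complex.exp (Complex.I * (ε n : ℂ) * t) - 1) / (ε n : ℂ)) atTop
      (𝓝 (Complex.I * t)) := by
    have hd : HasDerivAt (fun y : ℝ => Complex.exp (Complex.I * (y : ℂ) * t)) (Complex.I * t) 0 := by
      have h0 : HasDerivAt (fun y : ℝ => Complex.I * (y : ℂ) * t) (Complex.I * t) 0 := by
        simpa using ((hasDerivAt_id (0:ℝ)).ofReal_comp.const_mul Complex.I).mul_const (t : ℂ)
      simpa using h0.cexp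
    have := hd.tendsto_slope.comp (tendsto_nhdsWithin_iff.mpr ⟨hlim, .of_forall fun n => (hpos n).ne'⟩)
    refine this.congr fun n => ?_
    simp [slope_def_module, div_eq_inv_mul]
  have hlimC : Tendsto (fun n => (ε n : ℂ)) atTop (𝓝 0) := by
    simpa [Function.comp_def] using (Complex.continuous_ofReal.tendsto (0:ℝ)).comp hlim
  have hexp : Tendsto (fun n => Complex.exp (Complex.I * (ε n : ℂ) * t)) atTop (𝓝 1) := by
    have : Tendsto (fun n => Complex.I * (ε n : ℂ) * t) atTop (𝓝 (Complex.I * 0 * t)) :=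
      (hlimC.const_mul _).mul_const _
    simpa [Function.comp_def] using (Complex.continuous_exp.tendsto _).comp this
  have hmain : Tendsto (fun n => ((1 - ((1 - ε n ^ 2 : ℝ) : ℂ) * Complex.exp (Complex.I * (ε n : ℂ) * t))
      / (ε n : ℂ)) ^ (α : ℂ)) atTop (𝓝 ((-(Complex.I * t)) ^ (α : ℂ))) := by
    refine (Complex.continuousAt_cpow_const_of_re_pos (Or.inl (by simp))
      (by simpa using by linarith)).tendsto.comp ?_
    have : Tendsto (fun n => -((Complex.exp (Complex.I * (ε n : ℂ) * t) - 1) / (ε n : ℂ))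
      + (ε n : ℂ) * Complex.exp (Complex.I * (ε n : ℂ) * t)) atTop (𝓝 (-(Complex.I * t) + 0 * 1)) :=
      hder.neg.add (hlimC.mul hexp)
    simp only [zero_mul, add_zero] at this
    refine this.congr fun n => ?_
    have : (ε n : ℂ) ≠ 0 := by exact_mod_cast (hpos n).ne'
    push_cast
    field_simp
    ring
  have hrem : Tendsto (fun n => (((ε n)⁻¹ ^ α : ℝ) : ℂ) * (((1 - ε n ^ 2 : ℝ) : ℂ) *
      Complex.exp (Complex.I * (ε n : ℂ) * t) - (1 + Complex.I * (ε n : ℂ) * t))) atTop (𝓝 0) := by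
    have hp : Tendsto (fun n => (ε n) ^ (2 - α)) atTop (𝓝 0) := by
      have := hlim.rpow_const (p := 2 - α) (Or.inr (by linarith))
      rwa [Real.zero_rpow (by linarith)] at this
    have hbd : Tendsto (fun n => (ε n) ^ (2 - α) * (t ^ 2 + 1)) atTop (𝓝 0) := by
      simpa using hp.mul_const (t ^ 2 + 1)
    refine squeeze_zero_norm' ?_ hbd
    have hsm : ∀ᶠ n in atTop, ‖Complex.I * (ε n : ℂ) * t‖ < 1 := by
      have : Tendsto (fun n => Complex.I * (ε n : ℂ) * t) atTop (𝓝 (Complex.I * 0 * t)) :=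
        (hlimC.const_mul _).mul_const _
      have h' := this.norm
      simp only [mul_zero, zero_mul, norm_zero] at h'
      exact h'.eventually_lt_const one_pos
    filter_upwards [hsm] with n hn
    have hb := Complex.norm_exp_sub_one_sub_id_le hn.le
    have hnE : ‖Complex.exp (Complex.I * (ε n : ℂ) * t)‖ = 1 := by
      have : Complex.I * (ε n : ℂ) * (t : ℂ) = ((ε n * t : ℝ) : ℂ) * Complex.I := by
        push_cast; ring
      rw [this, Complex.norm_exp_ofReal_mul_I]
    have e1 : ((1 - ε n ^ 2 : ℝ) : ℂ) *
      Complex.exp (Complex.I * (ε n : ℂ) * t) - (1 + Complex.I * (ε n : ℂ) * t)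
      = (Complex.exp (Complex.I * (ε n : ℂ) * t) - 1 - Complex.I * (ε n : ℂ) * t)
        - ((ε n ^ 2 : ℝ) : ℂ) * Complex.exp (Complex.I * (ε n : ℂ) * t) := by push_cast; ring
    have e2 : ‖((1 - ε n ^ 2 : ℝ) : ℂ) *
      Complex.exp (Complex.I * (ε n : ℂ) * t) - (1 + Complex.I * (ε n : ℂ) * t)‖
      ≤ ε n ^ 2 * (t ^ 2 + 1) := by
      rw [e1]
      refine (norm_sub_le _ _).trans ?_
      have e3 : ‖((ε n ^ 2 : ℝ) : ℂ) * Complex.exp (Complex.I * (ε n : ℂ) * t)‖ = ε n ^ 2 := by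
        rw [norm_mul, hnE, Complex.norm_real, mul_one, Real.norm_eq_abs, abs_of_nonneg (sq_nonneg _)]
      have e4 : ‖Complex.I * (ε n : ℂ) * t‖ ^ 2 = ε n ^ 2 * t ^ 2 := by
        simp [mul_pow]
      rw [e3]
      rw [e4] at hb
      linarith
    rw [norm_mul, Complex.norm_real, Real.norm_eq_abs,
      abs_of_nonneg (by have := hpos n; positivity)]
    have e5 : (ε n)⁻¹ ^ α * ε n ^ 2 = ε n ^ (2 - α) := by
      rw [Real.inv_rpow (hpos n).le, Real.rpow_sub (hpos n), Real.rpow_two]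
      field_simp
    calc _ ≤ (ε n)⁻¹ ^ α * (ε n ^ 2 * (t ^ 2 + 1)) :=
          mul_le_mul_of_nonneg_left e2 (by have := hpos n; positivity)
      _ = _ := by rw [← mul_assoc, e5]
  have htot := (hmain.add (hrem.const_mul (α : ℂ))).const_mul (c : ℂ)
  simp only [mul_zero, add_zero] at htot
  refine htot.congr fun n => ?_
  have e6 : ((1 - ((1 - ε n ^ 2 : ℝ) : ℂ) * Complex.exp (Complex.I * (ε n : ℂ) * t))
      / (ε n : ℂ)) ^ (α : ℂ) = (((ε n)⁻¹ ^ α : ℝ) : ℂ) *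
      (1 - ((1 - ε n ^ 2 : ℝ) : ℂ) * Complex.exp (Complex.I * (ε n : ℂ) * t)) ^ (α : ℂ) := by
    rw [div_eq_inv_mul, ← Complex.ofReal_inv,
      real_mul_cpow' (inv_pos.mpr (hpos n)) _ (by linarith)]
  rw [e6]
  push_cast
  ring

/-- Half-line Fourier transform. -/
noncomputable def FT (g : ℝ → ℂ) (x : ℝ) : ℂ :=
  ∫ t in Ioi (0 : ℝ), Complex.exp (-(Complex.I * t * x)) * g t

lemma norm_kernel (t x : ℝ) : ‖Complex.exp (-(Complex.I * (t : ℂ) * x))‖ = 1 := by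
  have e : -(Complex.I * (t : ℂ) * x) = ((-(t * x) : ℝ) : ℂ) * Complex.I := by push_cast; ring
  rw [e, Complex.norm_exp_ofReal_mul_I]

lemma integrable_dom (K : ℝ) : IntegrableOn (fun t : ℝ => K * Real.exp (-(t / 2))) (Ioi 0) := by
  have := (integrableOn_exp_mul_Ioi (a := -(1/2 : ℝ)) (by norm_num) 0).const_mul K
  have e : (fun t : ℝ => K * Real.exp (-(t / 2))) = fun t : ℝ => K * Real.exp (-(1/2) * t) := by
    funext t
    congr 2
    ring
  rw [e]
  exact this

lemma integral_dom (K : ℝ) : ∫ t in Ioi (0 : ℝ), K * Real.exp (-(t / 2)) = 2 * K := by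
  rw [integral_const_mul]
  have := integral_exp_mul_Ioi (a := -(1/2 : ℝ)) (by norm_num) 0
  have e : (fun t : ℝ => Real.exp (-(t / 2))) = fun t : ℝ => Real.exp (-(1/2) * t) := by
    funext t
    congr 1
    ring
  rw [e, this]
  norm_num
  ring

lemma integrable_kernel {g : ℝ → ℂ} {K : ℝ} (hg : Continuous g)
    (b : ∀ t, 0 ≤ t → ‖g t‖ ≤ K * Real.exp (-(t / 2))) (x : ℝ) :
    IntegrableOn (fun t : ℝ => Complex.exp (-(Complex.I * t * x)) * g t) (Ioi 0) := by
  refine (integrable_dom K).mono' (by fun_prop) ?_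
  refine (ae_restrict_iff' measurableSet_Ioi).mpr (.of_forall fun t ht => ?_)
  rw [norm_mul, norm_kernel, one_mul]
  exact b t (le_of_lt ht)

lemma FT_bound {g : ℝ → ℂ} {K : ℝ}
    (b : ∀ t, 0 ≤ t → ‖g t‖ ≤ K * Real.exp (-(t / 2))) (x : ℝ) : ‖FT g x‖ ≤ 2 * K := by
  rw [← integral_dom K]
  refine norm_integral_le_of_norm_le (integrable_dom K) ?_
  refine (ae_restrict_iff' measurableSet_Ioi).mpr (.of_forall fun t ht => ?_)
  rw [norm_mul, norm_kernel, one_mul]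
  exact b t (le_of_lt ht)

lemma FT_hasDeriv {g : ℝ → ℂ} {K : ℝ} (hg : Continuous g)
    (b0 : ∀ t, 0 ≤ t → ‖g t‖ ≤ K * Real.exp (-(t / 2)))
    (b1 : ∀ t, 0 ≤ t → ‖-(Complex.I * t) * g t‖ ≤ K * Real.exp (-(t / 2))) (x : ℝ) :
    HasDerivAt (FT g) (FT (fun t => -(Complex.I * t) * g t) x) x := by
  refine (hasDerivAt_integral_of_dominated_loc_of_deriv_le (F := fun (x : ℝ) (t : ℝ) =>
    Complex.exp (-(Complex.I * t * x)) * g t) (F' := fun (x : ℝ) (t : ℝ) =>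
    Complex.exp (-(Complex.I * t * x)) * (-(Complex.I * t) * g t))
    (bound := fun t => K * Real.exp (-(t / 2))) (s := univ) univ_mem ?_ ?_ ?_ ?_ ?_ ?_).2
  · exact .of_forall fun y => by fun_prop
  · exact integrable_kernel hg b0 x
  · fun_prop
  · refine (ae_restrict_iff' measurableSet_Ioi).mpr (.of_forall fun t ht y _ => ?_)
    rw [norm_mul, norm_kernel, one_mul]
    exact b1 t (le_of_lt ht)
  · exact integrable_dom K
  · refine .of_forall fun t y _ => ?_
    have h0 : HasDerivAt (fun y : ℝ => -(Complex.I * t * (y : ℂ))) (-(Complex.I * t)) y := by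
      exact (((hasDerivAt_id y).ofReal_comp.const_mul (Complex.I * t)).neg).congr_deriv (by simp)
    exact ((h0.cexp).mul_const (g t)).congr_deriv (by ring)

lemma FT_decay {g g1 g2 : ℝ → ℂ} {K : ℝ} (hg : Continuous g) (hg1 : Continuous g1)
    (hg2 : Continuous g2) (d1 : ∀ t, 0 < t → HasDerivAt g (g1 t) t)
    (d2 : ∀ t, 0 < t → HasDerivAt g1 (g2 t) t)
    (b0 : ∀ t, 0 ≤ t → ‖g t‖ ≤ K * Real.exp (-(t / 2)))
    (b1 : ∀ t, 0 ≤ t → ‖g1 t‖ ≤ K * Real.exp (-(t / 2)))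
    (b2 : ∀ t, 0 ≤ t → ‖g2 t‖ ≤ K * Real.exp (-(t / 2)))
    (h0 : g 0 = 0) (x : ℝ) : ‖FT g x‖ ≤ 5 * K / (1 + x ^ 2) := by
  have key : ∫ t in Ioi (0 : ℝ), Complex.exp (-(Complex.I * t * x)) * (g2 t + x ^ 2 * g t)
      = 0 - Complex.exp (-(Complex.I * (0 : ℝ) * x)) * (g1 0 + Complex.I * x * g 0) := by
    refine integral_Ioi_of_hasDerivAt_of_tendsto
      (f := fun t : ℝ => Complex.exp (-(Complex.I * t * x)) * (g1 t + Complex.I * x * g t))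
      (Continuous.continuousWithinAt (by fun_prop)) ?_ ?_ ?_
    · intro t ht
      have hE : HasDerivAt (fun t : ℝ => -(Complex.I * (t : ℂ) * x)) (-(Complex.I * x)) t := by
        exact ((((hasDerivAt_id t).ofReal_comp.const_mul Complex.I).mul_const (x : ℂ)).neg).congr_deriv
          (by simp)
      refine (hE.cexp.mul ((d2 t ht).add ((d1 t ht).const_mul (Complex.I * x)))).congr_deriv ?_
      simp only [Pi.add_apply]
      linear_combination (-(Complex.exp (-(Complex.I * t * x)) * x ^ 2 * g t)) * Complex.I_sq
    · have h := (integrable_kernel hg2 b2 x).add ((integrable_kernel hg b0 x).const_mul ((x : ℂ) ^ 2))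
      refine h.congr (.of_forall fun t => ?_)
      simp only [Pi.add_apply]
      ring
    · have hb : Tendsto (fun t : ℝ => (K + |x| * K) * Real.exp (-(t / 2))) atTop (𝓝 0) := by
        have : Tendsto (fun t : ℝ => Real.exp (-(t / 2))) atTop (𝓝 0) :=
          Real.tendsto_exp_neg_atTop_nhds_zero.comp (tendsto_id.atTop_div_const two_pos)
        simpa using this.const_mul (K + |x| * K)
      refine squeeze_zero_norm' ?_ hb
      filter_upwards [eventually_ge_atTop 0] with t ht
      rw [norm_mul, norm_kernel, one_mul]
      refine (norm_add_le _ _).trans ?_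
      rw [norm_mul, norm_mul, Complex.norm_I, one_mul, Complex.norm_real, Real.norm_eq_abs]
      have := b1 t ht
      have := mul_le_mul_of_nonneg_left (b0 t ht) (abs_nonneg x)
      linarith
  have hsplit : ∫ t in Ioi (0 : ℝ), Complex.exp (-(Complex.I * t * x)) * (g2 t + x ^ 2 * g t)
      = FT g2 x + x ^ 2 * FT g x := by
    unfold FT
    rw [← integral_const_mul, ← integral_add (integrable_kernel hg2 b2 x)
      ((integrable_kernel hg b0 x).const_mul _)]
    congr 1
    funext t
    ring
  rw [hsplit, h0] at key
  have e : (x : ℂ) ^ 2 * FT g x = -(g1 0) - FT g2 x := by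
    have : Complex.exp (-(Complex.I * ((0 : ℝ) : ℂ) * x)) = 1 := by simp
    rw [this] at key
    linear_combination key
  have n1 := FT_bound b0 x
  have n2 := FT_bound b2 x
  have n3 : ‖g1 0‖ ≤ K := by simpa using b1 0 le_rfl
  have n4 : x ^ 2 * ‖FT g x‖ ≤ 3 * K := by
    have : ‖(x : ℂ) ^ 2 * FT g x‖ = x ^ 2 * ‖FT g x‖ := by
      rw [norm_mul, norm_pow, Complex.norm_real, Real.norm_eq_abs, sq_abs]
    rw [← this, e]
    refine (norm_sub_le _ _).trans ?_
    rw [norm_neg]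
    linarith
  rw [le_div_iff₀ (by positivity)]
  linarith

lemma FT_const_mul (c : ℂ) (g : ℝ → ℂ) (x : ℝ) : FT (fun t => c * g t) x = c * FT g x := by
  unfold FT
  rw [← integral_const_mul]
  congr 1
  funext t
  ring

/-- Pointwise bound of the score integrand from a nonnegative function with decaying derivatives. -/
lemma score_bound {f f1 f2 : ℝ → ℝ} {C : ℝ} (hC : 0 < C) (hf : ∀ x, 0 ≤ f x)
    (d1 : ∀ x, HasDerivAt f (f1 x) x) (d2 : ∀ x, HasDerivAt f1 (f2 x) x)
    (b1 : ∀ x, |f1 x| ≤ C / (1 + x ^ 2)) (b2 : ∀ x, |f2 x| ≤ C / (1 + x ^ 2)) (x : ℝ) :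
    f1 x ^ 2 / f x ≤ 12 * C / (1 + x ^ 2) := by
  set M := 3 * C / (1 + x ^ 2) with hM
  have hMpos : 0 < M := by positivity
  have hloc : ∀ y, |y - x| ≤ 1 → |f2 y| ≤ M := by
    intro y hy
    refine (b2 y).trans ?_
    rw [hM, div_le_div_iff₀ (by positivity) (by positivity)]
    have := abs_le.mp hy
    have : 1 + x ^ 2 ≤ 3 * (1 + y ^ 2) := by nlinarith [sq_nonneg (y - x), sq_nonneg (2 * y - x)]
    nlinarith
  have hf1 : |f1 x| ≤ M := by
    refine (b1 x).trans ?_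
    rw [hM]
    gcongr
    linarith
  set h := -f1 x / (2 * M) with hh
  have hh1 : |h| ≤ 1 := by
    rw [hh, abs_div, abs_neg, abs_of_pos (by positivity : (0:ℝ) < 2 * M), div_le_one (by positivity)]
    linarith
  -- Taylor upper bound
  have hconv : Convex ℝ (Metric.closedBall x |h|) := convex_closedBall _ _
  have hlip : ∀ y ∈ Metric.closedBall x |h|, |f1 y - f1 x| ≤ M * |h| := by
    intro y hy
    have hy' : |y - x| ≤ |h| := by simpa [Real.dist_eq] using hy
    have := hconv.norm_image_sub_le_of_norm_hasDerivWithin_le (f := f1) (f' := f2) (C := M)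
      (x := x) (y := y) (fun z _ => (d2 z).hasDerivWithinAt) (fun z hz => by
        have : |z - x| ≤ |h| := by simpa [Real.dist_eq] using hz
        exact hloc z (this.trans hh1)) (Metric.mem_closedBall_self (abs_nonneg _)) hy
    simp only [Real.norm_eq_abs] at this
    exact this.trans (mul_le_mul_of_nonneg_left hy' hMpos.le)
  have htay : |f (x + h) - f x - f1 x * h| ≤ M * |h| * |h| := by
    have := hconv.norm_image_sub_le_of_norm_hasDerivWithin_le (f := fun y => f y - f1 x * y)
      (f' := fun y => f1 y - f1 x) (C := M * |h|) (x := x) (y := x + h)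
      (fun z _ => by
        exact (((d1 z).sub ((hasDerivAt_id z).const_mul (f1 x))).congr_deriv
          (by simp)).hasDerivWithinAt)
      (fun z hz => hlip z hz) (Metric.mem_closedBall_self (abs_nonneg _))
      (by simp)
    simp only [Real.norm_eq_abs, add_sub_cancel_left] at this
    have e : f (x + h) - f x - f1 x * h = f (x + h) - f1 x * (x + h) - (f x - f1 x * x) := by ring
    rw [e]
    exact this
  have hpos := hf (x + h)
  have ht := (abs_le.mp htay).2
  rw [mul_assoc, abs_mul_abs_self] at ht
  have e1 : f1 x * h = - (f1 x ^ 2 / (2 * M)) := by rw [hh]; field_simp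
  have e2 : M * (h * h) = f1 x ^ 2 / (4 * M) := by rw [hh]; field_simp; ring
  have e3 : f1 x ^ 2 / (2 * M) = 2 * (f1 x ^ 2 / (4 * M)) := by field_simp; ring
  have h4 : f1 x ^ 2 / (4 * M) ≤ f x := by linarith
  have h5 : f1 x ^ 2 ≤ 4 * M * f x := by
    rw [div_le_iff₀ (by positivity)] at h4
    linarith
  have h6 : 12 * C / (1 + x ^ 2) = 4 * M := by rw [hM]; ring
  rw [h6]
  exact div_le_of_le_mul₀ (hf x) (by positivity) h5

/-- The characteristic function on the half line. -/
noncomputable def sphi (α η : ℝ) (t : ℝ) : ℂ :=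
  Complex.exp (-(1 - Complex.I * η) * ((t ^ α : ℝ) : ℂ) - Complex.I * η * t)

/-- Logarithmic derivative of `sphi`. -/
noncomputable def spd (α η : ℝ) (t : ℝ) : ℂ :=
  -(1 - Complex.I * η) * α * ((t ^ (α - 1) : ℝ) : ℂ) - Complex.I * η

/-- `t` times the derivative of `spd`. -/
noncomputable def swd (α η : ℝ) (t : ℝ) : ℂ :=
  -(1 - Complex.I * η) * α * (α - 1) * ((t ^ (α - 1) : ℝ) : ℂ)

lemma sphi_cont {α : ℝ} (h : 0 ≤ α) (η : ℝ) : Continuous (sphi α η) := by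
  have := Real.continuous_rpow_const h
  unfold sphi
  fun_prop

lemma spd_cont {α : ℝ} (h : 1 ≤ α) (η : ℝ) : Continuous (spd α η) := by
  have := Real.continuous_rpow_const (show 0 ≤ α - 1 by linarith)
  unfold spd
  fun_prop

lemma swd_cont {α : ℝ} (h : 1 ≤ α) (η : ℝ) : Continuous (swd α η) := by
  have := Real.continuous_rpow_const (show 0 ≤ α - 1 by linarith)
  unfold swd
  fun_prop

lemma sphi_deriv (α η : ℝ) {t : ℝ} (ht : 0 < t) :
    HasDerivAt (sphi α η) (spd α η t * sphi α η t) t := by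
  have h1 : HasDerivAt (fun t : ℝ => ((t ^ α : ℝ) : ℂ)) ((α * t ^ (α - 1) : ℝ) : ℂ) t :=
    (Real.hasDerivAt_rpow_const (Or.inl ht.ne')).ofReal_comp
  have h2 : HasDerivAt (fun t : ℝ => (t : ℂ)) 1 t := by
    simpa using (hasDerivAt_id t).ofReal_comp
  have h3 := ((h1.const_mul (-(1 - Complex.I * η))).sub (h2.const_mul (Complex.I * η))).cexp
  refine h3.congr_deriv ?_
  simp only [sphi, spd, Pi.sub_apply]
  push_cast
  ring

lemma spd_deriv (α η : ℝ) {t : ℝ} (ht : 0 < t) :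
    HasDerivAt (spd α η) (swd α η t / t) t := by
  have h1 : HasDerivAt (fun t : ℝ => ((t ^ (α - 1) : ℝ) : ℂ))
      (((α - 1) * t ^ (α - 1 - 1) : ℝ) : ℂ) t :=
    (Real.hasDerivAt_rpow_const (Or.inl ht.ne')).ofReal_comp
  have h3 := (h1.const_mul (-(1 - Complex.I * η) * α)).sub_const (Complex.I * η)
  refine h3.congr_deriv ?_
  have ht' : (t : ℂ) ≠ 0 := by exact_mod_cast ht.ne'
  rw [Real.rpow_sub_one ht.ne']
  simp only [swd]
  push_cast
  field_simp

lemma sphi_norm (α η : ℝ) (t : ℝ) : ‖sphi α η t‖ = Real.exp (-(t ^ α)) := by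
  rw [sphi, Complex.norm_exp]
  congr 1
  simp only [Complex.sub_re, Complex.re_mul_ofReal, Complex.neg_re, Complex.one_re, Complex.I_re,
    zero_mul, Complex.I_im, Complex.mul_re, Complex.ofReal_re, Complex.ofReal_im, mul_zero,
    sub_zero]
  simp

lemma sphi_le {α : ℝ} (h1 : 1 ≤ α) (η : ℝ) {t : ℝ} (ht : 0 ≤ t) :
    ‖sphi α η t‖ ≤ 3 * Real.exp (-t) := by
  rw [sphi_norm]
  have h : t - 1 ≤ t ^ α := by
    by_cases h' : t ≤ 1
    · have : 0 ≤ t ^ α := by positivity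
      linarith
    · push Not at h'
      have := Real.rpow_le_rpow_of_exponent_le h'.le h1
      rw [Real.rpow_one] at this
      linarith
  calc Real.exp (-(t ^ α)) ≤ Real.exp (1 + -t) := Real.exp_le_exp.mpr (by linarith)
    _ = Real.exp 1 * Real.exp (-t) := Real.exp_add _ _
    _ ≤ 3 * Real.exp (-t) := by
      have := Real.exp_one_lt_d9
      have h3 := Real.exp_pos (-t)
      nlinarith

lemma rpow_le_one_add {α t : ℝ} (h1 : 1 ≤ α) (h2 : α ≤ 2) (ht : 0 ≤ t) :
    t ^ (α - 1) ≤ 1 + t := by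
  by_cases h' : t ≤ 1
  · have := Real.rpow_le_one ht h' (show 0 ≤ α - 1 by linarith)
    linarith
  · push Not at h'
    have := Real.rpow_le_rpow_of_exponent_le h'.le (show α - 1 ≤ 1 by linarith)
    rw [Real.rpow_one] at this
    linarith

lemma norm_one_sub_le {η : ℝ} (h : |η| ≤ 1) : ‖-(1 - Complex.I * η)‖ ≤ 2 := by
  rw [norm_neg]
  refine (norm_sub_le _ _).trans ?_
  simp
  linarith

lemma spd_norm {α η : ℝ} (h1 : 1 ≤ α) (h2 : α ≤ 2) (hη : |η| ≤ 1) {t : ℝ} (ht : 0 ≤ t) :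
    ‖spd α η t‖ ≤ 5 * (1 + t) := by
  unfold spd
  refine (norm_sub_le _ _).trans ?_
  rw [norm_mul, norm_mul, norm_mul, Complex.norm_real, Complex.norm_real, Complex.norm_real,
    Complex.norm_I, Real.norm_eq_abs, Real.norm_eq_abs, Real.norm_eq_abs,
    abs_of_nonneg (show 0 ≤ α by linarith), abs_of_nonneg (show 0 ≤ t ^ (α - 1) by positivity)]
  have a := norm_one_sub_le hη
  have b := rpow_le_one_add h1 h2 ht
  have c : ‖-(1 - Complex.I * η)‖ * α * t ^ (α - 1) ≤ 2 * 2 * (1 + t) := by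
    gcongr
  linarith

lemma swd_norm {α η : ℝ} (h1 : 1 ≤ α) (h2 : α ≤ 2) (hη : |η| ≤ 1) {t : ℝ} (ht : 0 ≤ t) :
    ‖swd α η t‖ ≤ 4 * (1 + t) := by
  have e : swd α η t = -(1 - Complex.I * η) * (α : ℂ) * ((α - 1 : ℝ) : ℂ) *
    ((t ^ (α - 1) : ℝ) : ℂ) := by
    unfold swd; push_cast; ring
  rw [e]
  rw [norm_mul, norm_mul, norm_mul, Complex.norm_real, Complex.norm_real, Complex.norm_real,
    Real.norm_eq_abs, Real.norm_eq_abs, Real.norm_eq_abs, abs_of_nonneg (show 0 ≤ α - 1 by linarith),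
    abs_of_nonneg (show 0 ≤ α by linarith), abs_of_nonneg (show 0 ≤ t ^ (α - 1) by positivity)]
  have a := norm_one_sub_le hη
  have b := rpow_le_one_add h1 h2 ht
  have c : ‖-(1 - Complex.I * η)‖ * α * (α - 1) * t ^ (α - 1) ≤ 2 * 2 * 1 * (1 + t) := by
    gcongr
    linarith
  linarith

lemma poly_exp {t : ℝ} (ht : 0 ≤ t) :
    (1 + t) ^ 4 * Real.exp (-t) ≤ 4096 * Real.exp (-(t / 2)) := by
  have h : 1 + t ≤ 8 * Real.exp (t / 8) := by
    have := Real.add_one_le_exp (t / 8)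
    linarith
  have h4 : (1 + t) ^ 4 ≤ (8 * Real.exp (t / 8)) ^ 4 := by gcongr
  have e : (8 * Real.exp (t / 8)) ^ 4 = 4096 * Real.exp (t / 2) := by
    rw [mul_pow, ← Real.exp_nat_mul]
    norm_num
    ring_nf
  rw [e] at h4
  calc (1 + t) ^ 4 * Real.exp (-t) ≤ 4096 * Real.exp (t / 2) * Real.exp (-t) := by gcongr
    _ = 4096 * Real.exp (-(t / 2)) := by
      rw [mul_assoc, ← Real.exp_add]
      congr 2
      ring

lemma dom_of_poly {α : ℝ} (h1 : 1 ≤ α) (η : ℝ) {t : ℝ} (ht : 0 ≤ t) {A : ℂ}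
    (hA : ‖A‖ ≤ 51 * (1 + t) ^ 4) : ‖A * sphi α η t‖ ≤ 1000000 * Real.exp (-(t / 2)) := by
  rw [norm_mul]
  have a := sphi_le h1 η ht
  have b := poly_exp ht
  have hE := Real.exp_pos (-(t / 2))
  calc ‖A‖ * ‖sphi α η t‖ ≤ (51 * (1 + t) ^ 4) * (3 * Real.exp (-t)) := by gcongr
    _ = 153 * ((1 + t) ^ 4 * Real.exp (-t)) := by ring
    _ ≤ 153 * (4096 * Real.exp (-(t / 2))) := by gcongr
    _ ≤ _ := by nlinarith

lemma FT_one_decay {α η : ℝ} (h1 : 1 ≤ α) (h2 : α ≤ 2) (hη : |η| ≤ 1) (x : ℝ) :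
    ‖FT (fun t => (t : ℂ) * sphi α η t) x‖ ≤ 5000000 / (1 + x ^ 2) := by
  have c0 := sphi_cont (show 0 ≤ α by linarith) η
  have c1 := spd_cont h1 η
  have c2 := swd_cont h1 η
  have := FT_decay (K := 1000000) (g := fun t => (t : ℂ) * sphi α η t)
    (g1 := fun t => (1 + t * spd α η t) * sphi α η t)
    (g2 := fun t => (2 * spd α η t + swd α η t + t * spd α η t ^ 2) * sphi α η t)
    (by fun_prop) (by fun_prop) (by fun_prop) ?_ ?_ ?_ ?_ ?_ (by simp) x
  · norm_num at this
    exact this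
  · intro t ht
    have h2 : HasDerivAt (fun t : ℝ => (t : ℂ)) 1 t := by
      simpa using (hasDerivAt_id t).ofReal_comp
    refine (h2.mul (sphi_deriv α η ht)).congr_deriv ?_
    ring
  · intro t ht
    have h2 : HasDerivAt (fun t : ℝ => (t : ℂ)) 1 t := by
      simpa using (hasDerivAt_id t).ofReal_comp
    have ht' : (t : ℂ) ≠ 0 := by exact_mod_cast ht.ne'
    refine (((h2.mul (spd_deriv α η ht)).const_add 1).mul (sphi_deriv α η ht)).congr_deriv ?_
    simp only [Pi.mul_apply]
    field_simp
    ring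
  · intro t ht
    refine dom_of_poly h1 η ht ?_
    rw [Complex.norm_real, Real.norm_eq_abs, abs_of_nonneg ht]
    have : t ≤ (1 + t) ^ 4 := by nlinarith [pow_nonneg ht 3, pow_nonneg ht 2, pow_nonneg ht 4]
    nlinarith [pow_nonneg (show 0 ≤ 1 + t by linarith) 4]
  · intro t ht
    refine dom_of_poly h1 η ht ((norm_add_le _ _).trans ?_)
    rw [norm_mul, Complex.norm_real, Real.norm_eq_abs, abs_of_nonneg ht, norm_one]
    have := mul_le_mul_of_nonneg_left (spd_norm h1 h2 hη ht) ht
    nlinarith [pow_nonneg ht 3, pow_nonneg ht 2, pow_nonneg ht 4]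
  · intro t ht
    refine dom_of_poly h1 η ht (norm_add₃_le.trans ?_)
    rw [norm_mul, norm_mul, norm_pow, Complex.norm_real, Real.norm_eq_abs, abs_of_nonneg ht]
    have a := spd_norm h1 h2 hη ht
    have b := swd_norm h1 h2 hη ht
    have c : t * ‖spd α η t‖ ^ 2 ≤ t * (5 * (1 + t)) ^ 2 := by gcongr
    have d : ‖(2 : ℂ)‖ = 2 := by simp
    rw [d]
    nlinarith [pow_nonneg ht 3, pow_nonneg ht 2, pow_nonneg ht 4]

lemma FT_two_decay {α η : ℝ} (h1 : 1 ≤ α) (h2 : α ≤ 2) (hη : |η| ≤ 1) (x : ℝ) :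
    ‖FT (fun t => (t : ℂ) ^ 2 * sphi α η t) x‖ ≤ 5000000 / (1 + x ^ 2) := by
  have c0 := sphi_cont (show 0 ≤ α by linarith) η
  have c1 := spd_cont h1 η
  have c2 := swd_cont h1 η
  have := FT_decay (K := 1000000) (g := fun t => (t : ℂ) ^ 2 * sphi α η t)
    (g1 := fun t => (2 * t + t ^ 2 * spd α η t) * sphi α η t)
    (g2 := fun t => (2 + 4 * t * spd α η t + (t * swd α η t + t ^ 2 * spd α η t ^ 2)) * sphi α η t)
    (by fun_prop) (by fun_prop) (by fun_prop) ?_ ?_ ?_ ?_ ?_ (by simp) x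
  · norm_num at this
    exact this
  · intro t ht
    have h2 : HasDerivAt (fun t : ℝ => (t : ℂ)) 1 t := by
      simpa using (hasDerivAt_id t).ofReal_comp
    refine ((h2.pow 2).mul (sphi_deriv α η ht)).congr_deriv ?_
    simp only [Pi.pow_apply]
    push_cast
    ring
  · intro t ht
    have h2 : HasDerivAt (fun t : ℝ => (t : ℂ)) 1 t := by
      simpa using (hasDerivAt_id t).ofReal_comp
    have ht' : (t : ℂ) ≠ 0 := by exact_mod_cast ht.ne'
    refine (((h2.const_mul 2).add ((h2.pow 2).mul (spd_deriv α η ht))).mul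
      (sphi_deriv α η ht)).congr_deriv ?_
    simp only [Pi.mul_apply, Pi.add_apply, Pi.pow_apply]
    push_cast
    field_simp
    ring
  · intro t ht
    refine dom_of_poly h1 η ht ?_
    rw [norm_pow, Complex.norm_real, Real.norm_eq_abs, abs_of_nonneg ht]
    nlinarith [pow_nonneg ht 3, pow_nonneg ht 2, pow_nonneg ht 4]
  · intro t ht
    refine dom_of_poly h1 η ht ((norm_add_le _ _).trans ?_)
    rw [norm_mul, norm_mul, norm_pow, Complex.norm_real, Real.norm_eq_abs, abs_of_nonneg ht]
    have := mul_le_mul_of_nonneg_left (spd_norm h1 h2 hη ht) (pow_nonneg ht 2)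
    have d : ‖(2 : ℂ)‖ = 2 := by simp
    rw [d]
    nlinarith [pow_nonneg ht 3, pow_nonneg ht 2, pow_nonneg ht 4]
  · intro t ht
    refine dom_of_poly h1 η ht (norm_add₃_le.trans ?_)
    refine (add_le_add le_rfl (norm_add_le _ _)).trans ?_
    rw [norm_mul, norm_mul, norm_mul, norm_mul, norm_pow, norm_pow, Complex.norm_real,
      Real.norm_eq_abs, abs_of_nonneg ht]
    have a := mul_le_mul_of_nonneg_left (spd_norm h1 h2 hη ht) ht
    have b := mul_le_mul_of_nonneg_left (swd_norm h1 h2 hη ht) ht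
    have c : t ^ 2 * ‖spd α η t‖ ^ 2 ≤ t ^ 2 * (5 * (1 + t)) ^ 2 := by
      have := spd_norm h1 h2 hη ht
      gcongr
    have d : ‖(2 : ℂ)‖ = 2 := by simp
    have d' : ‖(4 : ℂ)‖ = 4 := by simp
    rw [d, d']
    nlinarith [pow_nonneg ht 3, pow_nonneg ht 2, pow_nonneg ht 4]

lemma density_eq {α : ℝ} (β x : ℝ) :
    stableDensity α β x = (1 / π) * (FT (sphi α (β * Real.tan (π * α / 2))) x).re := by
  unfold stableDensity FT
  congr 2
  refine setIntegral_congr_fun measurableSet_Ioi fun t ht => ?_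
  have ht' : (0 : ℝ) < t := ht
  simp only [sphi]
  congr 2
  have e : t ^ α * t ^ (1 - α) = t := by
    rw [← Real.rpow_add ht']; simp
  have e' : ((t ^ α : ℝ) : ℂ) * ((t ^ (1 - α) : ℝ) : ℂ) = t := by exact_mod_cast e
  push_cast at e' ⊢
  linear_combination (-(Complex.I * β * Complex.tan (π * α / 2))) * e'

lemma b_zero {α : ℝ} (h1 : 1 ≤ α) (η : ℝ) (t : ℝ) (ht : 0 ≤ t) :
    ‖sphi α η t‖ ≤ 1000000 * Real.exp (-(t / 2)) := by
  have := dom_of_poly h1 η ht (A := 1) (by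
    rw [norm_one]; nlinarith [pow_nonneg ht 3, pow_nonneg ht 2, pow_nonneg ht 4])
  simpa using this

lemma b_one {α : ℝ} (h1 : 1 ≤ α) (η : ℝ) (t : ℝ) (ht : 0 ≤ t) :
    ‖-(Complex.I * t) * sphi α η t‖ ≤ 1000000 * Real.exp (-(t / 2)) := by
  refine dom_of_poly h1 η ht ?_
  rw [norm_neg, norm_mul, Complex.norm_I, Complex.norm_real, Real.norm_eq_abs, abs_of_nonneg ht]
  nlinarith [pow_nonneg ht 3, pow_nonneg ht 2, pow_nonneg ht 4]

lemma b_two {α : ℝ} (h1 : 1 ≤ α) (η : ℝ) (t : ℝ) (ht : 0 ≤ t) :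
    ‖-(Complex.I * t) * (-(Complex.I * t) * sphi α η t)‖ ≤ 1000000 * Real.exp (-(t / 2)) := by
  rw [← mul_assoc]
  refine dom_of_poly h1 η ht ?_
  rw [norm_mul, norm_neg, norm_mul, Complex.norm_I, Complex.norm_real, Real.norm_eq_abs,
    abs_of_nonneg ht]
  nlinarith [pow_nonneg ht 3, pow_nonneg ht 2, pow_nonneg ht 4]

lemma density_nonneg {α β : ℝ} (h1 : 1 < α) (h2 : α < 2) (hβ : β ∈ Set.Ioo (-1 : ℝ) 1) (x : ℝ) :
    0 ≤ stableDensity α β x := by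
  rw [density_eq]
  refine mul_nonneg (by positivity) ?_
  set C := Real.cos (π * α / 2) with hC
  set S := Real.sin (π * α / 2) with hS
  have hCneg : C < 0 := by
    refine Real.cos_neg_of_pi_div_two_lt_of_lt ?_ ?_ <;> nlinarith [Real.pi_pos]
  have hT : Real.tan (π * α / 2) = S / C := Real.tan_eq_sin_div_cos _
  set η := β * Real.tan (π * α / 2) with hη
  set a := (1 + β) / (-2 * C) with ha
  set b := (1 - β) / (-2 * C) with hb
  have ha0 : 0 ≤ a := div_nonneg (by linarith [hβ.1]) (by linarith)
  have hb0 : 0 ≤ b := div_nonneg (by linarith [hβ.2]) (by linarith)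
  have hP := ((PosChar.stable h1 h2 ha0).mul (PosChar.stable h1 h2 hb0).conj).mul
    (PosChar.base 1 (-η) zero_le_one)
  have hI : (-Complex.I) ^ (α : ℂ) = (C : ℂ) - Complex.I * S := by
    rw [Complex.cpow_def_of_ne_zero (by simp), Complex.log_neg_I]
    have : -((π : ℂ) / 2) * Complex.I * α = ((-(π * α / 2) : ℝ) : ℂ) * Complex.I := by
      push_cast; ring
    rw [this, Complex.exp_mul_I, ← Complex.ofReal_cos, ← Complex.ofReal_sin, Real.cos_neg,
      Real.sin_neg]
    rw [← hC, ← hS, Complex.ofReal_neg]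
    ring
  have heq : ∀ t ∈ Ioi (0 : ℝ), Complex.exp ((a : ℂ) * (-(Complex.I * t)) ^ (α : ℂ)) *
      (starRingEnd ℂ) (Complex.exp ((b : ℂ) * (-(Complex.I * t)) ^ (α : ℂ))) *
      (((1 : ℝ) : ℂ) * Complex.exp (Complex.I * ((-η : ℝ) : ℂ) * t)) = sphi α η t := by
    intro t ht
    have ht' : (0 : ℝ) < t := ht
    have e1 : (-(Complex.I * t)) ^ (α : ℂ) = ((t ^ α : ℝ) : ℂ) * ((C : ℂ) - Complex.I * S) := by
      rw [← hI, ← real_mul_cpow' ht' _ (by linarith)]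
      congr 1
      ring
    have e2 : (starRingEnd ℂ) (Complex.exp ((b : ℂ) * (-(Complex.I * t)) ^ (α : ℂ)))
        = Complex.exp ((b : ℂ) * (((t ^ α : ℝ) : ℂ) * ((C : ℂ) + Complex.I * S))) := by
      rw [e1, ← Complex.exp_conj]
      congr 1
      simp only [map_mul, map_sub, Complex.conj_ofReal, Complex.conj_I]
      ring
    rw [e2, e1, Complex.ofReal_one, one_mul, ← Complex.exp_add, ← Complex.exp_add, sphi]
    congr 1
    have hC0 : C ≠ 0 := hCneg.ne
    have q1 : (a + b) * C = -1 := by rw [ha, hb]; field_simp; ring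
    have q2 : (a - b) * S = -η := by rw [ha, hb, hη, hT]; field_simp; ring
    have q1' : ((a : ℂ) + b) * C = -1 := by exact_mod_cast q1
    have q2' : ((a : ℂ) - b) * S = -η := by exact_mod_cast q2
    push_cast
    linear_combination ((t ^ α : ℝ) : ℂ) * q1' - Complex.I * ((t ^ α : ℝ) : ℂ) * q2'
  have hc := sphi_cont (show 0 ≤ α by linarith) η
  have hIntg : IntegrableOn (sphi α η) (Ioi 0) := by
    simpa using integrable_kernel hc (b_zero h1.le η) 0
  have hn := hP.integral_nonneg x (hIntg.congr_fun (fun t ht => (heq t ht).symm) measurableSet_Ioi)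
  have : FT (sphi α η) x = ∫ t in Ioi (0 : ℝ), Complex.exp (-(Complex.I * t * x)) *
      (Complex.exp ((a : ℂ) * (-(Complex.I * t)) ^ (α : ℂ)) *
      (starRingEnd ℂ) (Complex.exp ((b : ℂ) * (-(Complex.I * t)) ^ (α : ℂ))) *
      (((1 : ℝ) : ℂ) * Complex.exp (Complex.I * ((-η : ℝ) : ℂ) * t))) := by
    refine setIntegral_congr_fun measurableSet_Ioi fun t ht => ?_
    rw [heq t ht]
  rw [this]
  exact hn

lemma re_deriv {F : ℝ → ℂ} {F' : ℂ} {x : ℝ} (h : HasDerivAt F F' x) :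
    HasDerivAt (fun x => (1 / π) * (F x).re) ((1 / π) * F'.re) x := by
  have := (Complex.reCLM.hasFDerivAt.comp_hasDerivAt x h)
  exact this.const_mul _

lemma density_deriv {α : ℝ} (h1 : 1 ≤ α) (β x : ℝ) :
    HasDerivAt (stableDensity α β) ((1 / π) * (FT (fun t => -(Complex.I * t) *
      sphi α (β * Real.tan (π * α / 2)) t) x).re) x := by
  have e : stableDensity α β = fun x => (1 / π) *
    (FT (sphi α (β * Real.tan (π * α / 2))) x).re := funext fun x => density_eq β x
  rw [e]
  exact re_deriv (FT_hasDeriv (sphi_cont (by linarith) _) (b_zero h1 _) (b_one h1 _) x)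

lemma fX_eq {α : ℝ} (h1 : 1 ≤ α) (β x : ℝ) :
    fX α β x = (1 / π) * (FT (fun t => -(Complex.I * t) *
      sphi α (β * Real.tan (π * α / 2)) t) x).re := (density_deriv h1 β x).deriv

lemma integrand_bound {α β : ℝ} (h1 : 1 < α) (h2 : α < 2) (hβ : β ∈ Set.Ioo (-1 : ℝ) 1)
    (hη : |β * Real.tan (π * α / 2)| ≤ 1) (x : ℝ) :
    (fX α β x) ^ 2 / stableDensity α β x ≤ 12 * 5000000 / (1 + x ^ 2) := by
  set η := β * Real.tan (π * α / 2) with hηdef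
  have hpi : 1 / π ≤ 1 := by
    rw [div_le_one Real.pi_pos]; linarith [Real.pi_gt_three]
  have habs : ∀ z : ℂ, ∀ B : ℝ, ‖z‖ ≤ B → |(1 / π) * z.re| ≤ B := by
    intro z B hz
    rw [abs_mul, abs_of_pos (by positivity : 0 < 1 / π)]
    have := (Complex.abs_re_le_norm z).trans hz
    have h0 := abs_nonneg z.re
    have := mul_le_mul_of_nonneg_right hpi h0
    linarith
  have c0 := sphi_cont (show 0 ≤ α by linarith) η
  rw [fX_eq h1.le]
  refine score_bound (f := stableDensity α β) (f1 := fun x => (1 / π) * (FT (fun t =>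
    -(Complex.I * t) * sphi α η t) x).re) (f2 := fun x => (1 / π) * (FT (fun t =>
    -(Complex.I * t) * (-(Complex.I * t) * sphi α η t)) x).re) (by norm_num)
    (density_nonneg h1 h2 hβ) (density_deriv h1.le β) ?_ ?_ ?_ x
  · intro y
    exact re_deriv (FT_hasDeriv (by fun_prop) (b_one h1.le _) (b_two h1.le _) y)
  · intro y
    refine habs _ _ ?_
    have e : (fun t : ℝ => -(Complex.I * t) * sphi α η t)
        = fun t : ℝ => (-Complex.I) * ((t : ℂ) * sphi α η t) := by funext t; ring
    rw [e, FT_const_mul, norm_mul, norm_neg, Complex.norm_I, one_mul]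
    exact FT_one_decay h1.le h2.le hη y
  · intro y
    refine habs _ _ ?_
    have e : (fun t : ℝ => -(Complex.I * t) * (-(Complex.I * t) * sphi α η t))
        = fun t : ℝ => (-1) * ((t : ℂ) ^ 2 * sphi α η t) := by
      funext t
      linear_combination (t : ℂ) ^ 2 * sphi α η t * Complex.I_sq
    rw [e, FT_const_mul, norm_mul, norm_neg, norm_one, one_mul]
    exact FT_two_decay h1.le h2.le hη y

lemma eta_tendsto (β : ℝ) :
    Tendsto (fun Δ : ℝ => β * Real.tan (π * (2 - Δ) / 2)) (𝓝[>] 0) (𝓝 0) := by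
  have h : ContinuousAt Real.tan π := Real.continuousAt_tan.mpr (by simp)
  have h2 : Tendsto (fun Δ : ℝ => π * (2 - Δ) / 2) (𝓝[>] 0) (𝓝 π) := by
    have : Continuous (fun Δ : ℝ => π * (2 - Δ) / 2) := by fun_prop
    have := (this.tendsto 0).mono_left (nhdsWithin_le_nhds (s := Ioi 0))
    simpa using this
  have := (h.tendsto.comp h2).const_mul β
  simpa using this

lemma sphi_tendsto (β : ℝ) {t : ℝ} (ht : 0 < t) :
    Tendsto (fun Δ : ℝ => sphi (2 - Δ) (β * Real.tan (π * (2 - Δ) / 2)) t) (𝓝[>] 0)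
      (𝓝 (sphi 2 0 t)) := by
  have h1 : Tendsto (fun Δ : ℝ => t ^ (2 - Δ)) (𝓝[>] 0) (𝓝 (t ^ (2 : ℝ))) := by
    have hc : Continuous (fun Δ : ℝ => t ^ (2 - Δ)) :=
      (Real.continuous_const_rpow ht.ne').comp (by fun_prop)
    have := (hc.tendsto 0).mono_left (nhdsWithin_le_nhds (s := Ioi 0))
    simpa using this
  have h2 := (Complex.continuous_ofReal.tendsto _).comp h1
  have h3 := (Complex.continuous_ofReal.tendsto _).comp (eta_tendsto β)
  unfold sphi
  refine (Complex.continuous_exp.tendsto _).comp ?_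
  exact (((h3.const_mul Complex.I).const_sub 1).neg.mul h2).sub
    ((h3.const_mul Complex.I).mul_const _)

lemma FT_tendsto (β x : ℝ) (m : ℝ → ℂ) (hm : Continuous m)
    (hb : ∀ α η : ℝ, 1 ≤ α → ∀ t, 0 ≤ t → ‖m t * sphi α η t‖ ≤ 1000000 * Real.exp (-(t / 2))) :
    Tendsto (fun Δ : ℝ => FT (fun t => m t * sphi (2 - Δ) (β * Real.tan (π * (2 - Δ) / 2)) t) x)
      (𝓝[>] 0) (𝓝 (FT (fun t => m t * sphi 2 0 t) x)) := by
  have hev : ∀ᶠ Δ : ℝ in 𝓝[>] 0, Δ < 1 := nhdsWithin_le_nhds (Iio_mem_nhds one_pos)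
  refine tendsto_integral_filter_of_dominated_convergence
    (fun t => 1000000 * Real.exp (-(t / 2))) ?_ ?_ (integrable_dom _) ?_
  · filter_upwards [hev] with Δ hΔ
    have := sphi_cont (show 0 ≤ 2 - Δ by linarith) (β * Real.tan (π * (2 - Δ) / 2))
    fun_prop
  · filter_upwards [hev] with Δ hΔ
    refine (ae_restrict_iff' measurableSet_Ioi).mpr (.of_forall fun t ht => ?_)
    rw [norm_mul, norm_kernel, one_mul]
    exact hb _ _ (by linarith) t (le_of_lt ht)
  · refine (ae_restrict_iff' measurableSet_Ioi).mpr (.of_forall fun t ht => ?_)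
    exact ((sphi_tendsto β ht).const_mul _).const_mul _

lemma gauss_FT (x : ℝ) : (1 / π) * (FT (sphi 2 0) x).re = normalDensity x := by
  have h := PosChar.test_base_eq 0 x one_pos
  have e : FT (sphi 2 0) x = ∫ t in Ioi (0 : ℝ), Complex.exp (-(Complex.I * t * x)) *
      (Complex.exp (Complex.I * ((0 : ℝ) : ℂ) * t) * (Real.exp (-1 * t ^ 2) : ℝ)) := by
    refine setIntegral_congr_fun measurableSet_Ioi fun t ht => ?_
    simp [sphi]
  rw [e, h, normalDensity, div_one, ← Real.sqrt_eq_rpow]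
  have hs : Real.sqrt π * Real.sqrt π = π := Real.mul_self_sqrt Real.pi_pos.le
  have hs0 : 0 < Real.sqrt π := Real.sqrt_pos.mpr Real.pi_pos
  have e1 : -(0 - x) ^ 2 / (4 * 1) = -(x ^ 2) / 4 := by ring
  rw [e1]
  nth_rewrite 1 [← hs]
  field_simp

lemma gauss_FT_deriv (x : ℝ) :
    (1 / π) * (FT (fun t => -(Complex.I * t) * sphi 2 0 t) x).re = -(x / 2) * normalDensity x := by
  have h1 := re_deriv (FT_hasDeriv (sphi_cont (α := 2) (by norm_num) 0)
    (b_zero (by norm_num) _) (b_one (by norm_num) _) x)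
  simp only [gauss_FT] at h1
  have h2 : HasDerivAt normalDensity (-(x / 2) * normalDensity x) x := by
    have h3 : HasDerivAt (fun y : ℝ => -(y ^ 2) / 4) (-(x / 2)) x := by
      refine (((hasDerivAt_id x).pow 2).neg.div_const 4).congr_deriv ?_
      simp
      ring
    refine ((h3.exp).const_mul (1 / (2 * Real.sqrt π))).congr_deriv ?_
    unfold normalDensity
    ring
  exact h1.unique h2

lemma normal_moment : ∫ x : ℝ, x ^ 2 / 4 * normalDensity x = 1 / 2 := by
  have hv : (2 : NNReal) ≠ 0 := by norm_num
  have h := ProbabilityTheory.variance_fun_id_gaussianReal (μ := 0) (v := 2)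
  rw [ProbabilityTheory.variance_eq_integral (by fun_prop)] at h
  rw [ProbabilityTheory.integral_id_gaussianReal,
    ProbabilityTheory.integral_gaussianReal_eq_integral_smul hv] at h
  have e : (fun x : ℝ => x ^ 2 / 4 * normalDensity x) = fun x : ℝ =>
      (1 / 4) * (ProbabilityTheory.gaussianPDFReal 0 2 x • (x - 0) ^ 2) := by
    funext x
    simp only [normalDensity, ProbabilityTheory.gaussianPDFReal, smul_eq_mul, sub_zero]
    have e1 : Real.sqrt (2 * π * ((2 : NNReal) : ℝ)) = 2 * Real.sqrt π := by
      rw [show 2 * π * ((2 : NNReal) : ℝ) = 2 ^ 2 * π by push_cast; ring,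
        Real.sqrt_mul (by norm_num), Real.sqrt_sq (by norm_num)]
    have e2 : -x ^ 2 / (2 * ((2 : NNReal) : ℝ)) = -(x ^ 2) / 4 := by push_cast; ring
    rw [e1, e2]
    ring
  rw [e, integral_const_mul, h]
  norm_num

theorem fisher_information_mu_mu (β : ℝ) (hβ : β ∈ Set.Ioo (-1 : ℝ) 1) :
    Filter.Tendsto
      (fun Δ : ℝ => ∫ x : ℝ, (fX (2 - Δ) β x) ^ 2 / stableDensity (2 - Δ) β x)
      (nhdsWithin 0 (Set.Ioi 0)) (nhds (1 / 2)) := by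
  have hev : ∀ᶠ Δ : ℝ in 𝓝[>] 0, Δ < 1 := nhdsWithin_le_nhds (Iio_mem_nhds one_pos)
  have hev0 : ∀ᶠ Δ : ℝ in 𝓝[>] 0, 0 < Δ := self_mem_nhdsWithin
  have hη : ∀ᶠ Δ : ℝ in 𝓝[>] 0, |β * Real.tan (π * (2 - Δ) / 2)| ≤ 1 := by
    have := (eta_tendsto β).abs
    rw [abs_zero] at this
    exact (this.eventually_lt_const one_pos).mono fun _ h => h.le
  have hnd : ∀ x, 0 < normalDensity x := fun x => by unfold normalDensity; positivity
  rw [← normal_moment]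
  refine tendsto_integral_filter_of_dominated_convergence
    (fun x => 12 * 5000000 / (1 + x ^ 2)) ?_ ?_ ?_ ?_
  · filter_upwards [hev] with Δ hΔ
    have hm : Measurable (fX (2 - Δ) β) := measurable_deriv _
    have hc : Continuous (stableDensity (2 - Δ) β) := continuous_iff_continuousAt.mpr fun x =>
      (density_deriv (by linarith) β x).continuousAt
    exact ((hm.pow_const 2).div hc.measurable).aestronglyMeasurable
  · filter_upwards [hev, hev0, hη] with Δ h1 h0 h2
    refine .of_forall fun x => ?_
    have hn := density_nonneg (α := 2 - Δ) (by linarith) (by linarith) hβ x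
    rw [Real.norm_eq_abs, abs_of_nonneg (div_nonneg (sq_nonneg _) hn)]
    exact integrand_bound (by linarith) (by linarith) hβ h2 x
  · simpa [div_eq_mul_inv] using integrable_inv_one_add_sq.const_mul (12 * 5000000 : ℝ)
  · refine .of_forall fun x => ?_
    have t0 : Tendsto (fun Δ : ℝ => stableDensity (2 - Δ) β x) (𝓝[>] 0) (𝓝 (normalDensity x)) := by
      rw [← gauss_FT x]
      have := FT_tendsto β x (fun _ => 1) continuous_const
        (fun α η h t ht => by simpa using b_zero h η t ht)
      simp only [one_mul] at this
      have := ((Complex.continuous_re.tendsto _).comp this).const_mul (1 / π)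
      exact this.congr fun Δ => (density_eq β x).symm
    have t1 : Tendsto (fun Δ : ℝ => fX (2 - Δ) β x) (𝓝[>] 0)
        (𝓝 (-(x / 2) * normalDensity x)) := by
      rw [← gauss_FT_deriv x]
      have := FT_tendsto β x (fun t => -(Complex.I * t)) (by fun_prop)
        (fun α η h t ht => b_one h η t ht)
      have := ((Complex.continuous_re.tendsto _).comp this).const_mul (1 / π)
      refine this.congr' ?_
      filter_upwards [hev] with Δ hΔ
      exact (fX_eq (by linarith) β x).symm
    have t2 := (t1.pow 2).div t0 (hnd x).ne'
    have e : (-(x / 2) * normalDensity x) ^ 2 / normalDensity x = x ^ 2 / 4 * normalDensity x := by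
      have := (hnd x).ne'
      field_simp
      ring
    rw [e] at t2
    exact t2
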